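/- Let p ∈ (1,3]. Let R₀, C₀, M, M', δ > 0, α, β with β ∈ ℂ ∖ {0}, λ ≥ 2, and let ω₀ : ℝ² → ℝ be smooth with compact support. Let K be a compact subset of B(0,R₀), U = ℝ² ∖ K, and let T be an injective holomorphic map of U onto {z ∈ ℂ : |z| > 1} with |T(z)| ≥ 1 on U, of the form T(z) = βz + h(z) with h : U → ℂ bounded holomorphic and sup_U |h| ≤ M; assume |DT(x)| ≤ C₀ for |x| ≥ R₀, ‖DT‖_{L³(U ∩ B(0,R₀))} ≤ M, |det D(T⁻¹)(z)| ≤ M' for all |z| > 1, supp ω₀ ⊂ U ∩ B(0,R₀), and |T(y)| ≥ 1 + δ for all y ∈ supp ω₀. Fix Φ ∈ C^∞(ℝ) non-decreasing with 0 ≤ Φ ≤ 1, Φ(s) = 0 for s ≤ 1 and Φ(s) = 1 for s ≥ 2. Define W₀(x) = K_T[ω₀](x) + α (1 − Φ((|T(x)|−1)/λ)) H_T(x) for x ∈ U, extended by 0 on K. Then ‖W₀‖_{L^p(ℝ²)} ≤ C, where C depends only on p, α, β, C₀, R₀, M, M', δ, λ, Φ, sup|ω₀| and the support of ω₀ (and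 not otherwise on T or K). -/

import Mathlib

open MeasureTheory Metric Set Filter

noncomputable section

/-- counterclockwise rotation of a vector of ℝ² ≃ ℂ by a right angle: `(x₁,x₂) ↦ (-x₂,x₁)` -/
def perp (v : ℂ) : ℂ := Complex.I * v

/-- the real (euclidean) dot product on ℝ² ≃ ℂ -/
def dotR (a b : ℂ) : ℝ := a.re * b.re + a.im * b.im

/-- the transpose of a real-linear map of ℝ² ≃ ℂ, applied to a vector `w` -/
def transApply (L : ℂ →L[ℝ] ℂ) (w : ℂ) : ℂ :=
  (dotR (L 1) w : ℂ) + (dotR (L Complex.I) w : ℂ) * Complex.I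

/-- the harmonic vector field `H_T(x) = (1/2π) DT(x)^T (T(x)^⊥ / |T(x)|²)` -/
def HT (T : ℂ → ℂ) (x : ℂ) : ℂ :=
  (1 / (2 * Real.pi)) • transApply (fderiv ℝ T x) ((‖T x‖ ^ 2)⁻¹ • perp (T x))

/-- `T(y)* = T(y)/|T(y)|²` -/
def starT (T : ℂ → ℂ) (y : ℂ) : ℂ := (‖T y‖ ^ 2)⁻¹ • T y

/-- the Biot–Savart-type operator
`K_T[ω](x) = (1/2π) DT(x)^T ∫ ((T(x)−T(y))^⊥/|T(x)−T(y)|² − (T(x)−T(y)*)^⊥/|T(x)−T(y)*|²) ω(y) dy` -/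
def KT (T : ℂ → ℂ) (ω : ℂ → ℝ) (x : ℂ) : ℂ :=
  (1 / (2 * Real.pi)) • transApply (fderiv ℝ T x)
    (∫ y : ℂ, ω y • ((‖T x - T y‖ ^ 2)⁻¹ • perp (T x - T y)
      - (‖T x - starT T y‖ ^ 2)⁻¹ • perp (T x - starT T y)))

open scoped Topology ENNReal

theorem Set.InjOn.volume_deriv_eq_zero {T : ℂ → ℂ} {U : Set ℂ} (hU : IsOpen U)
    (hT : DifferentiableOn ℂ T U) (hinj : InjOn T U) :
    volume {y ∈ U | deriv T y = 0} = 0 := by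
  refine measure_null_of_locally_null _ fun y hy => ?_
  have han : AnalyticAt ℂ (deriv T) y := (hT.deriv hU).analyticAt (hU.mem_nhds hy.1)
  rcases han.eventually_eq_zero_or_eventually_ne_zero with h0 | h1
  · exfalso
    obtain ⟨ε, hε, hball⟩ := Metric.eventually_nhds_iff_ball.1
      (h0.and (hU.eventually_mem hy.1))
    obtain ⟨z, hz, hzy⟩ : ∃ z ∈ ball y ε, z ≠ y := by
      refine ⟨y + (ε / 2 : ℝ), ?_, ?_⟩
      · simp only [mem_ball, dist_self_add_left, Complex.norm_real, Real.norm_eq_abs]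
        rw [abs_of_pos (by positivity)]
        linarith
      · simp [hε.ne']
    refine hzy (hinj (hball z hz).2 hy.1 ?_)
    exact isOpen_ball.is_const_of_deriv_eq_zero (convex_ball y ε).isPreconnected
      (hT.mono fun w hw => (hball w hw).2) (fun w hw => (hball w hw).1) hz (mem_ball_self hε)
  · refine ⟨{y}, ?_, by simp⟩
    rw [eventually_nhdsWithin_iff] at h1
    filter_upwards [mem_nhdsWithin_of_mem_nhds h1, self_mem_nhdsWithin] with z hz hz'
    by_contra hne
    exact hz hne hz'.2

theorem abs_det_fderiv_mul_abs_det_fderiv_of_leftInverse {T S : ℂ → ℂ} {y : ℂ}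
    (hT : AnalyticAt ℂ T y) (h0 : deriv T y ≠ 0) (hS : ∀ᶠ x in 𝓝 y, S (T x) = x) :
    |(fderiv ℝ S (T y)).det| * |(fderiv ℝ T y).det| = 1 := by
  have hSd : DifferentiableAt ℝ S (T y) :=
    ((hT.hasStrictDerivAt.to_local_left_inverse h0 hS).hasDerivAt.differentiableAt).restrictScalars ℝ
  have hTd : DifferentiableAt ℝ T y := hT.differentiableAt.restrictScalars ℝ
  have hcomp := hSd.hasFDerivAt.comp y hTd.hasFDerivAt
  have hid : HasFDerivAt (S ∘ T) (ContinuousLinearMap.id ℝ ℂ) y :=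
    (hasFDerivAt_id y).congr_of_eventuallyEq hS
  have := congrArg ContinuousLinearMap.det (hcomp.unique hid)
  rw [← abs_mul]
  simp only [ContinuousLinearMap.det, ContinuousLinearMap.toLinearMap_comp,
    ContinuousLinearMap.coe_id, LinearMap.det_comp, LinearMap.det_id] at this ⊢
  rw [this, abs_one]

theorem setLIntegral_comp_le_mul_setLIntegral_image {T S : ℂ → ℂ} {U s : Set ℂ} {M' : ℝ}
    (hU : IsOpen U) (hT : DifferentiableOn ℂ T U) (hinj : InjOn T U)
    (hS : ∀ z : ℂ, 1 < ‖z‖ → S z ∈ U ∧ T (S z) = z)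
    (hdet : ∀ z : ℂ, 1 < ‖z‖ → |LinearMap.det ((fderiv ℝ S z : ℂ →ₗ[ℝ] ℂ))| ≤ M')
    (hs : MeasurableSet s) (hsU : s ⊆ U) (hsT : ∀ y ∈ s, 1 < ‖T y‖) (g : ℂ → ℝ≥0∞) :
    ∫⁻ y in s, g (T y) ≤ ENNReal.ofReal M' * ∫⁻ z in T '' s, g z := by
  have hd : ∀ y ∈ U, DifferentiableAt ℂ T y := fun y hy => hT.differentiableAt (hU.mem_nhds hy)
  rw [lintegral_image_eq_lintegral_abs_det_fderiv_mul volume hs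
    (fun y hy => (((hd y (hsU hy)).restrictScalars ℝ).hasFDerivAt).hasFDerivWithinAt)
    (hinj.mono hsU) g, ← lintegral_const_mul' _ _ ENNReal.ofReal_ne_top]
  refine setLIntegral_mono_ae' hs ?_
  have hnull := hinj.volume_deriv_eq_zero hU hT
  filter_upwards [measure_eq_zero_iff_ae_notMem.1 hnull] with y hy hys
  have hyU := hsU hys
  have h0 : deriv T y ≠ 0 := fun h => hy ⟨hyU, h⟩
  have hleft : ∀ᶠ x in 𝓝 y, S (T x) = x := by
    filter_upwards [hU.mem_nhds hyU,
      (hd y hyU).continuousAt.norm.eventually (lt_mem_nhds (hsT y hys))] with x hx hx1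
    exact hinj (hS _ hx1).1 hx (hS _ hx1).2
  have hone := abs_det_fderiv_mul_abs_det_fderiv_of_leftInverse
    (hT.analyticAt (hU.mem_nhds hyU)) h0 hleft
  have hle : (1 : ℝ) ≤ M' * |(fderiv ℝ T y).det| := by
    rw [← hone]
    exact mul_le_mul_of_nonneg_right (hdet _ (hsT y hys)) (abs_nonneg _)
  rw [← mul_assoc, ← ENNReal.ofReal_mul ((abs_nonneg _).trans (hdet _ (hsT y hys)))]
  exact le_mul_of_one_le_left' (by simpa using ENNReal.ofReal_le_ofReal hle)

theorem lintegral_ball_enorm_inv_lt_top : ∫⁻ u in ball (0 : ℂ) 1, ‖u‖ₑ⁻¹ < ∞ := by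
  have hi : IntegrableOn (fun u : ℂ => ‖u‖⁻¹) (ball (0 : ℂ) 1) := by
    refine (integrableOn_fun_norm_addHaar volume (f := fun r : ℝ => r⁻¹) (r := 1)).2 ?_
    refine (integrableOn_congr_fun (g := fun _ : ℝ => (1 : ℝ)) (fun r hr => ?_)
      measurableSet_Ioo).2 (by simp)
    have : r ≠ 0 := hr.1.ne'
    simp [this]
  refine lt_of_eq_of_lt (setLIntegral_congr_fun_ae measurableSet_ball ?_) hi.hasFiniteIntegral
  filter_upwards [measure_eq_zero_iff_ae_notMem.1 (measure_singleton (0 : ℂ))] with u hu _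
  rw [enorm_inv (by simpa using hu)]
  simp

theorem setLIntegral_enorm_sub_inv_le (w : ℂ) (s : Set ℂ) :
    ∫⁻ z in s, ‖w - z‖ₑ⁻¹ ≤ (∫⁻ u in ball (0 : ℂ) 1, ‖u‖ₑ⁻¹) + volume s := by
  calc ∫⁻ z in s, ‖w - z‖ₑ⁻¹
      ≤ ∫⁻ z in s, ((ball (0 : ℂ) 1).indicator (fun u => ‖u‖ₑ⁻¹) (w - z) + 1) := by
        refine lintegral_mono fun z => ?_
        by_cases hz : w - z ∈ ball (0 : ℂ) 1
        · rw [indicator_of_mem hz]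
          exact le_self_add
        · rw [indicator_of_notMem hz, zero_add, ENNReal.inv_le_one]
          rw [mem_ball_zero_iff, not_lt] at hz
          rw [← ofReal_norm]
          simpa using ENNReal.ofReal_le_ofReal hz
    _ = (∫⁻ z in s, (ball (0 : ℂ) 1).indicator (fun u => ‖u‖ₑ⁻¹) (w - z)) + volume s := by
        rw [lintegral_add_right _ measurable_const]
        simp
    _ ≤ (∫⁻ z, (ball (0 : ℂ) 1).indicator (fun u => ‖u‖ₑ⁻¹) (w - z)) + volume s := by
        gcongr
        exact Measure.restrict_le_self
    _ = _ := by
        rw [lintegral_sub_left_eq_self, lintegral_indicator measurableSet_ball]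

theorem norm_inv_sq_smul_perp (a : ℂ) : ‖(‖a‖ ^ 2)⁻¹ • perp a‖ = ‖a‖⁻¹ := by
  rcases eq_or_ne a 0 with rfl | ha
  · simp [perp]
  · have : ‖a‖ ≠ 0 := norm_ne_zero_iff.2 ha
    simp only [perp, norm_smul, norm_inv, norm_pow, norm_norm, norm_mul, Complex.norm_I, one_mul]
    field_simp

theorem enorm_inv_sq_smul_perp_le (a : ℂ) : ‖(‖a‖ ^ 2)⁻¹ • perp a‖ₑ ≤ ‖a‖ₑ⁻¹ := by
  rcases eq_or_ne a 0 with rfl | ha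
  · simp
  · rw [← enorm_inv ha]
    refine le_of_eq ?_
    rw [← ofReal_norm, ← ofReal_norm, norm_inv_sq_smul_perp, norm_inv]

theorem inv_sq_smul_perp_eq (a : ℂ) :
    (‖a‖ ^ 2)⁻¹ • perp a = Complex.I * ((starRingEnd ℂ) a)⁻¹ := by
  rw [Complex.inv_def, Complex.conj_conj, Complex.normSq_conj, Complex.normSq_eq_norm_sq,
    Complex.real_smul, perp]
  push_cast
  ring

theorem norm_inv_sq_smul_perp_sub {a b : ℂ} (ha : a ≠ 0) (hb : b ≠ 0) :
    ‖(‖a‖ ^ 2)⁻¹ • perp a - (‖b‖ ^ 2)⁻¹ • perp b‖ = ‖a - b‖ / (‖a‖ * ‖b‖) := by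
  rw [inv_sq_smul_perp_eq, inv_sq_smul_perp_eq, ← mul_sub,
    inv_sub_inv (by simpa using ha) (by simpa using hb), ← map_sub]
  simp only [norm_mul, norm_div, Complex.norm_I, one_mul, Complex.norm_conj, norm_sub_rev]

theorem abs_dotR_le (a b : ℂ) : |dotR a b| ≤ ‖a‖ * ‖b‖ := by
  have h : dotR a b = ((starRingEnd ℂ) a * b).re := by simp [dotR]
  rw [h]
  exact (Complex.abs_re_le_norm _).trans (by simp)

theorem norm_transApply_le (L : ℂ →L[ℝ] ℂ) (w : ℂ) : ‖transApply L w‖ ≤ 2 * ‖L‖ * ‖w‖ := by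
  have h (v : ℂ) (hv : ‖v‖ = 1) : |dotR (L v) w| ≤ ‖L‖ * ‖w‖ := by
    refine (abs_dotR_le _ _).trans ?_
    gcongr
    simpa [hv] using L.le_opNorm v
  refine (norm_add_le _ _).trans ?_
  have h1 := h 1 (by simp)
  have h2 := h Complex.I (by simp)
  simp only [norm_mul, Complex.norm_real, Complex.norm_I, mul_one, Real.norm_eq_abs]
  linarith

theorem norm_smul_transApply_le (L : ℂ →L[ℝ] ℂ) (w : ℂ) :
    ‖(1 / (2 * Real.pi)) • transApply L w‖ ≤ ‖L‖ * ‖w‖ := by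
  have hπ : 1 / (2 * Real.pi) ≤ 1 / 2 := by
    apply one_div_le_one_div_of_le <;> linarith [Real.pi_gt_three]
  rw [norm_smul, Real.norm_of_nonneg (by positivity)]
  calc 1 / (2 * Real.pi) * ‖transApply L w‖ ≤ 1 / 2 * (2 * ‖L‖ * ‖w‖) := by
        gcongr
        exact norm_transApply_le L w
    _ = _ := by ring

theorem norm_HT_le {T : ℂ → ℂ} {x : ℂ} (hx : 1 ≤ ‖T x‖) : ‖HT T x‖ ≤ ‖fderiv ℝ T x‖ := by
  refine (norm_smul_transApply_le _ _).trans ?_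
  rw [norm_inv_sq_smul_perp]
  exact mul_le_of_le_one_right (norm_nonneg _) (inv_le_one_of_one_le₀ hx)

theorem norm_starT (T : ℂ → ℂ) (y : ℂ) : ‖starT T y‖ = ‖T y‖⁻¹ := by
  rw [← norm_inv_sq_smul_perp]
  simp [starT, perp]

/-- The integral in the definition of `KT`. -/
def biotSavartIntegral (T : ℂ → ℂ) (ω : ℂ → ℝ) (x : ℂ) : ℂ :=
  ∫ y : ℂ, ω y • ((‖T x - T y‖ ^ 2)⁻¹ • perp (T x - T y)
      - (‖T x - starT T y‖ ^ 2)⁻¹ • perp (T x - starT T y))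

theorem norm_KT_le (T : ℂ → ℂ) (ω : ℂ → ℝ) (x : ℂ) :
    ‖KT T ω x‖ ≤ ‖fderiv ℝ T x‖ * ‖biotSavartIntegral T ω x‖ :=
  norm_smul_transApply_le _ _

theorem enorm_biotSavartIntegral_le {T S : ℂ → ℂ} {U : Set ℂ} {ω : ℂ → ℝ} {M' W A δ R : ℝ}
    (hδ : 0 < δ) (hU : IsOpen U) (hT : DifferentiableOn ℂ T U) (hinj : InjOn T U)
    (hS : ∀ z : ℂ, 1 < ‖z‖ → S z ∈ U ∧ T (S z) = z)
    (hdet : ∀ z : ℂ, 1 < ‖z‖ → |LinearMap.det ((fderiv ℝ S z : ℂ →ₗ[ℝ] ℂ))| ≤ M')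
    (hW : ∀ y, ‖ω y‖ ≤ W) (hsupp : tsupport ω ⊆ U ∩ ball 0 R)
    (hA : ∀ y ∈ tsupport ω, ‖T y‖ ≤ A) (hTδ : ∀ y ∈ tsupport ω, 1 + δ ≤ ‖T y‖)
    {x : ℂ} (hx : 1 ≤ ‖T x‖) :
    ‖biotSavartIntegral T ω x‖ₑ ≤ ENNReal.ofReal W *
      (ENNReal.ofReal M' * ((∫⁻ u in ball (0 : ℂ) 1, ‖u‖ₑ⁻¹) + volume (closedBall (0 : ℂ) A))
        + ENNReal.ofReal ((1 + δ) / δ) * volume (ball (0 : ℂ) R)) := by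
  have hs : MeasurableSet (tsupport ω) := (isClosed_tsupport ω).measurableSet
  have hkernel : ∀ y ∈ tsupport ω,
      ‖(‖T x - starT T y‖ ^ 2)⁻¹ • perp (T x - starT T y)‖ₑ ≤ ENNReal.ofReal ((1 + δ) / δ) := by
    intro y hy
    rw [← ofReal_norm, norm_inv_sq_smul_perp]
    refine ENNReal.ofReal_le_ofReal ?_
    have h1 : ‖starT T y‖ ≤ (1 + δ)⁻¹ := by
      rw [norm_starT]
      exact inv_anti₀ (by positivity) (hTδ y hy)
    have h2 : δ / (1 + δ) ≤ ‖T x - starT T y‖ := by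
      have h3 := norm_sub_norm_le (T x) (starT T y)
      have h4 : δ / (1 + δ) = 1 - (1 + δ)⁻¹ := by field_simp; ring
      linarith
    rw [← inv_div]
    exact inv_anti₀ (by positivity) h2
  calc ‖biotSavartIntegral T ω x‖ₑ
      ≤ ∫⁻ y, (tsupport ω).indicator (fun y => ENNReal.ofReal W *
          (‖T x - T y‖ₑ⁻¹ + ENNReal.ofReal ((1 + δ) / δ))) y := by
        refine (enorm_integral_le_lintegral_enorm _).trans (lintegral_mono fun y => ?_)
        by_cases hy : y ∈ tsupport ω
        · rw [indicator_of_mem hy, enorm_smul]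
          gcongr
          · rw [← ofReal_norm]
            exact ENNReal.ofReal_le_ofReal (hW y)
          · exact (enorm_sub_le).trans (add_le_add (enorm_inv_sq_smul_perp_le _) (hkernel y hy))
        · simp [image_eq_zero_of_notMem_tsupport hy]
    _ = ENNReal.ofReal W * ((∫⁻ y in tsupport ω, ‖T x - T y‖ₑ⁻¹)
          + ENNReal.ofReal ((1 + δ) / δ) * volume (tsupport ω)) := by
        rw [lintegral_indicator hs, lintegral_const_mul' _ _ ENNReal.ofReal_ne_top,
          lintegral_add_right _ measurable_const, setLIntegral_const]
    _ ≤ _ := by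
        gcongr
        · refine (setLIntegral_comp_le_mul_setLIntegral_image hU hT hinj hS hdet hs
            (fun y hy => (hsupp hy).1) (fun y hy => by linarith [hTδ y hy])
            (fun z => ‖T x - z‖ₑ⁻¹)).trans ?_
          gcongr
          refine (setLIntegral_enorm_sub_inv_le _ _).trans ?_
          gcongr
          rintro _ ⟨y, hy, rfl⟩
          exact mem_closedBall_zero_iff.2 (hA y hy)
        · exact fun y hy => (hsupp hy).2

theorem norm_biotSavartIntegral_le_of_le {T : ℂ → ℂ} {ω : ℂ → ℝ} {W A R : ℝ}
    (hA1 : 1 ≤ A) (hW : ∀ y, ‖ω y‖ ≤ W) (hsupp : tsupport ω ⊆ ball 0 R)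
    (hA : ∀ y ∈ tsupport ω, ‖T y‖ ≤ A) (hT1 : ∀ y ∈ tsupport ω, 1 ≤ ‖T y‖)
    {x : ℂ} (hx : 2 * A ≤ ‖T x‖) :
    ‖biotSavartIntegral T ω x‖ ≤
      W * (8 * A / ‖T x‖ ^ 2) * volume.real (ball (0 : ℂ) R) := by
  have hW0 : 0 ≤ W := (norm_nonneg _).trans (hW 0)
  have hTx : 0 < ‖T x‖ := by linarith
  rw [biotSavartIntegral, ← setIntegral_eq_integral_of_forall_compl_eq_zero (s := ball (0 : ℂ) R)]
  · refine norm_setIntegral_le_of_norm_le_const measure_ball_lt_top fun y _ => ?_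
    by_cases hy : y ∈ tsupport ω
    · rw [norm_smul]
      gcongr
      · exact hW y
      have hstar : ‖starT T y‖ ≤ 1 := by
        rw [norm_starT]
        exact inv_le_one_of_one_le₀ (hT1 y hy)
      have ha : ‖T x‖ / 2 ≤ ‖T x - T y‖ := by
        linarith [norm_sub_norm_le (T x) (T y), hA y hy]
      have hb : ‖T x‖ / 2 ≤ ‖T x - starT T y‖ := by
        linarith [norm_sub_norm_le (T x) (starT T y)]
      have hab : ‖(T x - T y) - (T x - starT T y)‖ ≤ 2 * A := by
        rw [sub_sub_sub_cancel_left]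
        linarith [norm_sub_le (starT T y) (T y), hA y hy]
      rw [norm_inv_sq_smul_perp_sub (norm_pos_iff.1 (by linarith)) (norm_pos_iff.1 (by linarith))]
      calc _ ≤ 2 * A / (‖T x‖ / 2 * (‖T x‖ / 2)) := by gcongr
        _ = _ := by field_simp; norm_num
    · rw [image_eq_zero_of_notMem_tsupport hy, zero_smul, norm_zero]
      positivity
  · intro y hy
    rw [image_eq_zero_of_notMem_tsupport (fun h => hy (hsupp h)), zero_smul]

theorem memLp_one_add_norm_rpow_neg_two {p : ℝ} (hp : 1 < p) :
    MemLp (fun x : ℂ => (1 + ‖x‖) ^ (-2 : ℝ)) (ENNReal.ofReal p) := by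
  have hm : AEStronglyMeasurable (fun x : ℂ => (1 + ‖x‖) ^ (-2 : ℝ)) :=
    Measurable.aestronglyMeasurable (by fun_prop)
  rw [← integrable_norm_rpow_iff hm (by simp; linarith) ENNReal.ofReal_ne_top,
    ENNReal.toReal_ofReal (by linarith)]
  refine (integrable_one_add_norm (E := ℂ) (μ := volume) (r := 2 * p) (by simp; linarith)).congr
    (Eventually.of_forall fun x => ?_)
  have h1 : (0 : ℝ) ≤ 1 + ‖x‖ := by positivity
  dsimp only
  rw [Real.norm_of_nonneg (by positivity), ← Real.rpow_mul h1]
  ring_nf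

theorem eLpNorm_fderiv_restrict_le {p M R : ℝ} (hp : 1 < p) (hp3 : p ≤ 3) {T : ℂ → ℂ} {s : Set ℂ}
    (hsR : s ⊆ ball 0 R)
    (h3 : eLpNorm (fun x => fderiv ℝ T x) 3 (volume.restrict s) ≤ ENNReal.ofReal M) :
    eLpNorm (fun x => fderiv ℝ T x) (ENNReal.ofReal p) (volume.restrict s) ≤
      ENNReal.ofReal M * volume (ball (0 : ℂ) R) ^ (1 / p - 1 / 3) := by
  refine (eLpNorm_le_eLpNorm_mul_rpow_measure_univ (q := 3) ?_
    (measurable_fderiv ℝ T).aestronglyMeasurable).trans ?_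
  · simpa using ENNReal.ofReal_le_ofReal hp3
  · rw [ENNReal.toReal_ofReal (by linarith), Measure.restrict_apply_univ, ENNReal.toReal_ofNat]
    gcongr
    rw [sub_nonneg]
    exact one_div_le_one_div_of_le (by linarith) hp3

theorem eLpNorm_le_of_norm_le_indicator_fderiv_add {p M R C₁ C₂ : ℝ} (hp : 1 < p) (hp3 : p ≤ 3)
    {T W : ℂ → ℂ} {s : Set ℂ} (hs : MeasurableSet s) (hsR : s ⊆ ball 0 R)
    (h3 : eLpNorm (fun x => fderiv ℝ T x) 3 (volume.restrict s) ≤ ENNReal.ofReal M)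
    (hW : ∀ x, ‖W x‖ ≤ C₁ * s.indicator (fun x => ‖fderiv ℝ T x‖) x
      + C₂ * (1 + ‖x‖) ^ (-2 : ℝ)) :
    eLpNorm W (ENNReal.ofReal p) ≤
      ‖C₁‖ₑ * (ENNReal.ofReal M * volume (ball (0 : ℂ) R) ^ (1 / p - 1 / 3))
      + ‖C₂‖ₑ * eLpNorm (fun x : ℂ => (1 + ‖x‖) ^ (-2 : ℝ)) (ENNReal.ofReal p) := by
  have hmeas : Measurable (s.indicator (fun x => ‖fderiv ℝ T x‖)) :=
    ((measurable_fderiv ℝ T).norm).indicator hs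
  refine (eLpNorm_mono_real hW).trans ?_
  refine (eLpNorm_add_le (hmeas.const_mul C₁).aestronglyMeasurable
    (Measurable.aestronglyMeasurable (by fun_prop)) (by simpa using hp.le)).trans ?_
  gcongr
  · refine (eLpNorm_const_smul C₁ _ _ _).le.trans ?_
    gcongr
    rw [eLpNorm_indicator_eq_eLpNorm_restrict hs, eLpNorm_norm]
    exact eLpNorm_fderiv_restrict_le hp hp3 hsR h3
  · exact (eLpNorm_const_smul C₂ _ _ _).le

/-- Uniform `L^p` bound, `1 < p ≤ 3`, for
`W₀ = K_T[ω₀] + α (1 − Φ((|T|−1)/λ)) H_T` (extended by `0` on `K`), with a constant depending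
only on `p, α, β, C₀, R₀, M, M', δ, λ, Φ` and `ω₀` (and not otherwise on `T` or `K`). -/
theorem truncated_initial_velocity_Lp_bound
    (p : ℝ) (hp1 : 1 < p) (hp3 : p ≤ 3)
    (R₀ C₀ M M' δ α lam : ℝ) (β : ℂ)
    (hR₀ : 0 < R₀) (hC₀ : 0 < C₀) (hM : 0 < M) (hM' : 0 < M') (hδ : 0 < δ)
    (hβ : β ≠ 0) (hlam : 2 ≤ lam)
    (Φ : ℝ → ℝ) (hΦs : ContDiff ℝ (⊤ : ℕ∞) Φ) (hΦm : Monotone Φ)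
    (hΦ01 : ∀ s : ℝ, 0 ≤ Φ s ∧ Φ s ≤ 1)
    (hΦ0 : ∀ s : ℝ, s ≤ 1 → Φ s = 0) (hΦ1 : ∀ s : ℝ, 2 ≤ s → Φ s = 1)
    (ω₀ : ℂ → ℝ) (hω : ContDiff ℝ (⊤ : ℕ∞) ω₀) (hωc : HasCompactSupport ω₀) :
    ∃ C : ℝ, 0 < C ∧
      ∀ (K : Set ℂ) (T h S : ℂ → ℂ),
        IsCompact K → K ⊆ Metric.ball 0 R₀ →
        Set.InjOn T Kᶜ →
        DifferentiableOn ℂ T Kᶜ →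
        Set.SurjOn T Kᶜ {z : ℂ | 1 < ‖z‖} →
        (∀ z ∈ Kᶜ, 1 ≤ ‖T z‖) →
        DifferentiableOn ℂ h Kᶜ →
        (∀ z ∈ Kᶜ, ‖h z‖ ≤ M) →
        (∀ z ∈ Kᶜ, T z = β * z + h z) →
        (∀ x ∈ Kᶜ, R₀ ≤ ‖x‖ → ‖fderiv ℝ T x‖ ≤ C₀) →
        eLpNorm (fun x => fderiv ℝ T x) 3 (volume.restrict (Kᶜ ∩ Metric.ball 0 R₀))
          ≤ ENNReal.ofReal M →
        (∀ z : ℂ, 1 < ‖z‖ → S z ∈ Kᶜ ∧ T (S z) = z) →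
        (∀ z : ℂ, 1 < ‖z‖ → |LinearMap.det ((fderiv ℝ S z : ℂ →ₗ[ℝ] ℂ))| ≤ M') →
        tsupport ω₀ ⊆ Kᶜ ∩ Metric.ball 0 R₀ →
        (∀ y ∈ tsupport ω₀, 1 + δ ≤ ‖T y‖) →
        ∀ W₀ : ℂ → ℂ,
          (∀ x ∈ Kᶜ, W₀ x = KT T ω₀ x
            + (α * (1 - Φ ((‖T x‖ - 1) / lam))) • HT T x) →
          (∀ x ∈ K, W₀ x = 0) →
          eLpNorm W₀ (ENNReal.ofReal p) volume ≤ ENNReal.ofReal C := by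
  obtain ⟨W, hW⟩ : ∃ W, ∀ y, ‖ω₀ y‖ ≤ W := hωc.exists_bound_of_continuous hω.continuous
  have hW0 : 0 ≤ W := (norm_nonneg _).trans (hW 0)
  have hβ0 : 0 < ‖β‖ := norm_pos_iff.2 hβ
  set A : ℝ := ‖β‖ * R₀ + M + 1
  have hA1 : 1 ≤ A := by linarith [mul_pos hβ0 hR₀]
  set Je : ℝ≥0∞ := ENNReal.ofReal W *
    (ENNReal.ofReal M' * ((∫⁻ u in ball (0 : ℂ) 1, ‖u‖ₑ⁻¹) + volume (closedBall (0 : ℂ) A))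
      + ENNReal.ofReal ((1 + δ) / δ) * volume (ball (0 : ℂ) R₀))
  have hJe_top : Je ≠ ∞ := by
    have h1 := lintegral_ball_enorm_inv_lt_top.ne
    have h2 : volume (closedBall (0 : ℂ) A) ≠ ∞ := measure_closedBall_lt_top.ne
    have h3 : volume (ball (0 : ℂ) R₀) ≠ ∞ := measure_ball_lt_top.ne
    finiteness
  set J : ℝ := Je.toReal
  have hJ0 : 0 ≤ J := ENNReal.toReal_nonneg
  set R : ℝ := 1 + R₀ + 2 * (M + 2 * A + 1 + 2 * lam) / ‖β‖
  have hRge : 1 + R₀ ≤ R := le_add_of_nonneg_right (by positivity)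
  set V : ℝ := volume.real (ball (0 : ℂ) R₀)
  have hV0 : 0 ≤ V := measureReal_nonneg
  set C₁ : ℝ := J + |α|
  have hC₁ : 0 ≤ C₁ := by positivity
  set C₂ : ℝ := C₀ * C₁ * (1 + R) ^ 2 + C₀ * (W * (8 * A * (16 / ‖β‖ ^ 2)) * V)
  have hC₂ : 0 ≤ C₂ := by positivity
  set Q : ℝ≥0∞ := ‖C₁‖ₑ * (ENNReal.ofReal M * volume (ball (0 : ℂ) R₀) ^ (1 / p - 1 / 3))
      + ‖C₂‖ₑ * eLpNorm (fun x : ℂ => (1 + ‖x‖) ^ (-2 : ℝ)) (ENNReal.ofReal p)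
  have hQ : Q ≠ ∞ := by
    have h1 : volume (ball (0 : ℂ) R₀) ^ (1 / p - 1 / 3) ≠ ∞ :=
      ENNReal.rpow_ne_top_of_nonneg
        (sub_nonneg.2 (one_div_le_one_div_of_le (by linarith) hp3)) measure_ball_lt_top.ne
    have h2 := (memLp_one_add_norm_rpow_neg_two hp1).eLpNorm_ne_top
    finiteness
  refine ⟨Q.toReal + 1, by positivity, ?_⟩
  intro K T h S hK hKR hinj hT _ hT1 _ hhM hTh hDC h3 hS hdet hsupp hTδ W₀ hW₀ hW₀K
  have hU : IsOpen Kᶜ := hK.isClosed.isOpen_compl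
  have hTA : ∀ y ∈ tsupport ω₀, ‖T y‖ ≤ A := by
    intro y hy
    have hyR : ‖y‖ ≤ R₀ := (mem_ball_zero_iff.1 (hsupp hy).2).le
    rw [hTh y (hsupp hy).1]
    have h1 := norm_add_le (β * y) (h y)
    rw [norm_mul] at h1
    linarith [hhM y (hsupp hy).1, mul_le_mul_of_nonneg_left hyR hβ0.le]
  have hnear : ∀ x ∈ Kᶜ, ‖W₀ x‖ ≤ C₁ * ‖fderiv ℝ T x‖ := by
    intro x hx
    have hI : ‖biotSavartIntegral T ω₀ x‖ ≤ J := by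
      have h1 : ‖biotSavartIntegral T ω₀ x‖ₑ ≤ Je :=
        enorm_biotSavartIntegral_le hδ hU hT hinj hS hdet hW hsupp hTA hTδ (hT1 x hx)
      simpa using ENNReal.toReal_mono hJe_top h1
    have hΦ : |α * (1 - Φ ((‖T x‖ - 1) / lam))| ≤ |α| := by
      rw [abs_mul]
      refine mul_le_of_le_one_right (abs_nonneg _) ?_
      obtain ⟨h0, h1⟩ := hΦ01 ((‖T x‖ - 1) / lam)
      rw [abs_of_nonneg] <;> linarith
    rw [hW₀ x hx]
    refine (norm_add_le _ _).trans ?_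
    rw [norm_smul, Real.norm_eq_abs]
    calc _ ≤ ‖fderiv ℝ T x‖ * J + |α| * ‖fderiv ℝ T x‖ := by
          gcongr
          · exact (norm_KT_le T ω₀ x).trans (by gcongr)
          · exact norm_HT_le (hT1 x hx)
      _ = C₁ * ‖fderiv ℝ T x‖ := by ring
  have hfar : ∀ x ∈ Kᶜ, R ≤ ‖x‖ →
      ‖W₀ x‖ ≤ C₀ * (W * (8 * A * (16 / ‖β‖ ^ 2)) * V) * (1 + ‖x‖) ^ (-2 : ℝ) := by
    intro x hx hxR
    have hβx : 2 * (M + 2 * A + 1 + 2 * lam) ≤ ‖β‖ * ‖x‖ := by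
      have h1 : 2 * (M + 2 * A + 1 + 2 * lam) / ‖β‖ ≤ ‖x‖ := by linarith
      rwa [div_le_iff₀' hβ0] at h1
    have hTx : ‖β‖ * ‖x‖ / 2 ≤ ‖T x‖ := by
      rw [hTh x hx]
      have h1 := norm_sub_le_norm_add (β * x) (h x)
      rw [norm_mul] at h1
      linarith [hhM x hx]
    have hΦx : Φ ((‖T x‖ - 1) / lam) = 1 := by
      apply hΦ1
      rw [le_div_iff₀ (by linarith)]
      linarith
    have hI := norm_biotSavartIntegral_le_of_le hA1 hW (fun y hy => (hsupp hy).2) hTA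
      (fun y hy => by linarith [hTδ y hy]) (x := x) (by linarith)
    have hx1 : (1 + ‖x‖) / 2 ≤ ‖x‖ := by linarith
    have hTx' : ‖β‖ * (1 + ‖x‖) / 4 ≤ ‖T x‖ := by
      linarith [mul_le_mul_of_nonneg_left hx1 hβ0.le]
    rw [hW₀ x hx, hΦx, sub_self, mul_zero, zero_smul, add_zero, Real.rpow_neg (by positivity),
      Real.rpow_two]
    calc ‖KT T ω₀ x‖ ≤ ‖fderiv ℝ T x‖ * ‖biotSavartIntegral T ω₀ x‖ := norm_KT_le _ _ _
      _ ≤ C₀ * (W * (8 * A / ‖T x‖ ^ 2) * V) := by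
          gcongr
          exact hDC x hx (by linarith)
      _ ≤ C₀ * (W * (8 * A / (‖β‖ * (1 + ‖x‖) / 4) ^ 2) * V) := by gcongr
      _ = _ := by
          have : 1 + ‖x‖ ≠ 0 := by positivity
          field_simp
          ring
  refine (eLpNorm_le_of_norm_le_indicator_fderiv_add (C₁ := C₁) (C₂ := C₂) hp1 hp3
    (hU.measurableSet.inter measurableSet_ball) inter_subset_right h3 fun x => ?_).trans ?_
  · have hpow : 0 ≤ (1 + ‖x‖) ^ (-2 : ℝ) := by positivity
    have hind : 0 ≤ (Kᶜ ∩ ball 0 R₀).indicator (fun x => ‖fderiv ℝ T x‖) x :=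
      indicator_nonneg (fun _ _ => norm_nonneg _) _
    by_cases hx : x ∈ K
    · rw [hW₀K x hx, norm_zero]
      positivity
    rcases lt_or_ge ‖x‖ R₀ with hxR₀ | hxR₀
    · rw [indicator_of_mem (show x ∈ Kᶜ ∩ ball 0 R₀ from ⟨hx, mem_ball_zero_iff.2 hxR₀⟩)]
      linarith [hnear x hx, mul_nonneg hC₂ hpow]
    refine le_add_of_nonneg_of_le (by positivity) ?_
    rcases lt_or_ge ‖x‖ R with hxR | hxR
    · calc ‖W₀ x‖ ≤ C₁ * ‖fderiv ℝ T x‖ := hnear x hx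
        _ ≤ C₁ * C₀ := by gcongr; exact hDC x hx hxR₀
        _ ≤ C₁ * C₀ * ((1 + R) ^ 2 * (1 + ‖x‖) ^ (-2 : ℝ)) := by
            refine le_mul_of_one_le_right (by positivity) ?_
            rw [Real.rpow_neg (by positivity), Real.rpow_two, ← div_eq_mul_inv,
              one_le_div (by positivity)]
            gcongr
        _ = C₀ * C₁ * (1 + R) ^ 2 * (1 + ‖x‖) ^ (-2 : ℝ) := by ring
        _ ≤ C₂ * (1 + ‖x‖) ^ (-2 : ℝ) := by
            gcongr
            exact le_add_of_nonneg_right (by positivity)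
    · refine (hfar x hx hxR).trans ?_
      gcongr
      exact le_add_of_nonneg_left (by positivity)
  · exact (ENNReal.ofReal_toReal hQ).ge.trans
      (ENNReal.ofReal_le_ofReal (le_add_of_nonneg_right zero_le_one))

end
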